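/- Consider the canonical one-parameter family F_a(x_1,…,x_n) = Σ_{i=1}^n x_i^{d/w_i} + a·x_1 x_2 ⋯ x_n. (i) For a ∈ ℂ there exists x ∈ ℂ^n, x ≠ 0, at which all partial derivatives of F_a vanish if and only if a^d · ∏_{i=1}^n w_i^{w_i} + (−1)^{d−1} · d^d = 0. (ii) If a satisfies this equation, then the set { x ∈ ℂ^n : x_1 = 1, ∇F_a(x) = 0 } is finite with exactly d^{n−2}/(w_2 ⋯ w_n) elements, and at each such point the (n−1)×(n−1) Hessian matrix of second partial derivatives of G(x_2,…,x_n) := F_a(1,x_2,…,x_n) is invertible (i.e. all singularities are ordinary double points). -/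

import Mathlib

/- Statement 4: the canonical one-parameter family
F_a = Σ x_i^{d/w_i} + a·x_1⋯x_n (here n = m+2):
(i) the discriminant is a^d ∏ w_i^{w_i} + (−1)^{d−1} d^d = 0;
(ii) on the discriminant the chart x_1 = 1 contains exactly
d^{n−2}/(w_2⋯w_n) critical points and each is an ordinary double point
(the Hessian of G = F_a(1,x_2,…,x_n) is invertible there). -/

noncomputable def Fcan {m : ℕ} (d : ℕ) (w : Fin (m + 2) → ℕ) (a : ℂ)
    (x : Fin (m + 2) → ℂ) : ℂ :=
  (∑ i, x i ^ (d / w i)) + a * ∏ i, x i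

lemma count_aux {k : ℕ} (q : Fin k → ℕ) (hq : ∀ i, 0 < q i) (d : ℕ) (hd : 0 < d)
    (hqd : ∀ i, q i ∣ d) (hl : ∀ N, (∀ i, q i ∣ N) → d ∣ N) (b : Fin k → ℂ)
    (hb : ∀ i, b i ≠ 0) (p : ℂ) (hp : p ≠ 0) (h : p ^ d = ∏ i, b i ^ (d / q i)) :
    {y : Fin k → ℂ | (∀ i, y i ^ q i = b i) ∧ ∏ i, y i = p}.Finite ∧
    {y : Fin k → ℂ | (∀ i, y i ^ q i = b i) ∧ ∏ i, y i = p}.ncard * d = ∏ i, q i := by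
  classical
  have : ∀ i, NeZero (q i) := fun i => ⟨(hq i).ne'⟩
  have : NeZero d := ⟨hd.ne'⟩
  let φ : (∀ i, rootsOfUnity (q i) ℂ) →* ℂˣ :=
    { toFun := fun g => ∏ i, (g i : ℂˣ)
      map_one' := by simp
      map_mul' := fun g g' => by simp [Finset.prod_mul_distrib] }
  have hφ : ∀ g, φ g = ∏ i, (g i : ℂˣ) := fun g => rfl
  have hle : φ.range ≤ rootsOfUnity d ℂ := by
    rintro _ ⟨g, rfl⟩
    rw [mem_rootsOfUnity, hφ, ← Finset.prod_pow]
    refine Finset.prod_eq_one fun i _ => ?_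
    obtain ⟨c, hc⟩ := hqd i
    have := (g i).2
    rw [mem_rootsOfUnity] at this
    rw [hc, pow_mul, this, one_pow]
  have hcard : ∀ e : ℕ, [NeZero e] → Nat.card (rootsOfUnity e ℂ) = e := fun e _ => by
    exact Complex.card_rootsOfUnity e
  have hfin : Finite φ.range := Finite.of_injective _ (Subgroup.inclusion_injective hle)
  have hge : d ∣ Nat.card φ.range := by
    apply hl
    intro i
    rw [← hcard (q i)]
    apply Subgroup.card_dvd_of_le
    intro z hz
    refine ⟨Pi.mulSingle i ⟨z, hz⟩, ?_⟩
    rw [hφ, Finset.prod_eq_single i]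
    · simp
    · intro j _ hj
      rw [Pi.mulSingle_eq_of_ne hj]; rfl
    · simp
  have hrange : φ.range = rootsOfUnity d ℂ := by
    apply Subgroup.eq_of_le_of_card_ge hle
    rw [hcard]
    exact Nat.le_of_dvd Nat.card_pos hge
  have hker : Nat.card φ.ker * d = ∏ i, q i := by
    have h1 := Subgroup.card_mul_index φ.ker
    rw [Subgroup.index_ker, hrange, hcard, Nat.card_pi] at h1
    simpa only [hcard] using h1
  -- a base point
  have hex : ∀ i, ∃ z : ℂ, z ^ q i = b i := fun i => by
    obtain ⟨z, hz⟩ := IsAlgClosed.exists_pow_nat_eq (b i) (hq i)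
    exact ⟨z, hz⟩
  choose z hz using hex
  have hz0 : ∀ i, z i ≠ 0 := fun i h0 => hb i (by rw [← hz i, h0, zero_pow (hq i).ne'])
  have hPz : ∏ i, z i ≠ 0 := Finset.prod_ne_zero_iff.2 fun i _ => hz0 i
  have hzd : (∏ i, z i) ^ d = p ^ d := by
    rw [h, ← Finset.prod_pow]
    refine Finset.prod_congr rfl fun i _ => ?_
    rw [← hz i, ← pow_mul, Nat.mul_div_cancel' (hqd i)]
  have hmem : Units.mk0 (p / ∏ i, z i) (div_ne_zero hp hPz) ∈ φ.range := by
    rw [hrange, mem_rootsOfUnity]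
    ext
    simp only [Units.val_pow_eq_pow_val, Units.val_mk0, Units.val_one]
    rw [div_pow, hzd, div_self (pow_ne_zero _ hp)]
  obtain ⟨g₀, hg₀⟩ := hmem
  have hpow : ∀ (g : ∀ i, rootsOfUnity (q i) ℂ) (i), ((g i : ℂˣ) : ℂ) ^ q i = 1 := fun g i => by
    have := (g i).2
    rw [mem_rootsOfUnity] at this
    rw [← Units.val_pow_eq_pow_val, this, Units.val_one]
  let y : Fin k → ℂ := fun i => ((g₀ i : ℂˣ) : ℂ) * z i
  have hy : ∀ i, y i ^ q i = b i := fun i => by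
    simp only [y]; rw [mul_pow, hpow, hz, one_mul]
  have hyp : ∏ i, y i = p := by
    simp only [y]
    have := congrArg Units.val hg₀
    rw [hφ, Units.coe_prod, Units.val_mk0] at this
    rw [Finset.prod_mul_distrib, this, div_mul_cancel₀ _ hPz]
  have hy0 : ∀ i, y i ≠ 0 := fun i h0 => hb i (by rw [← hy i, h0, zero_pow (hq i).ne'])
  let f : φ.ker → (Fin k → ℂ) := fun g i => ((g.1 i : ℂˣ) : ℂ) * y i
  have hf : Function.Injective f := by
    intro g g' hgg
    apply Subtype.ext
    funext i
    apply Subtype.ext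
    apply Units.ext
    exact mul_right_cancel₀ (hy0 i) (congrFun hgg i)
  have hset : {y : Fin k → ℂ | (∀ i, y i ^ q i = b i) ∧ ∏ i, y i = p} = Set.range f := by
    ext x
    constructor
    · rintro ⟨hx, hxp⟩
      have hx0 : ∀ i, x i ≠ 0 := fun i h0 => hb i (by rw [← hx i, h0, zero_pow (hq i).ne'])
      refine ⟨⟨fun i => ⟨Units.mk0 (x i / y i) (div_ne_zero (hx0 i) (hy0 i)), ?_⟩, ?_⟩, ?_⟩
      · rw [mem_rootsOfUnity]
        ext
        simp only [Units.val_pow_eq_pow_val, Units.val_mk0, Units.val_one]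
        rw [div_pow, hx, hy, div_self (hb i)]
      · rw [MonoidHom.mem_ker, hφ]
        ext
        rw [Units.coe_prod]
        simp only [Units.val_mk0, Units.val_one]
        rw [Finset.prod_div_distrib, hxp, hyp, div_self hp]
      · funext i
        simp only [f, Units.val_mk0]
        exact div_mul_cancel₀ _ (hy0 i)
    · rintro ⟨g, rfl⟩
      refine ⟨fun i => ?_, ?_⟩
      · simp only [f]; rw [mul_pow, hpow, hy, one_mul]
      · simp only [f]
        have := congrArg Units.val (MonoidHom.mem_ker.1 g.2)
        rw [hφ, Units.coe_prod, Units.val_one] at this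
        rw [Finset.prod_mul_distrib, this, hyp, one_mul]
  rw [hset]
  refine ⟨Set.finite_range f, ?_⟩
  rw [← hker, ← Nat.card_coe_set_eq, Nat.card_congr (Equiv.ofInjective f hf)]

lemma Fcan_update {m : ℕ} (d : ℕ) (w : Fin (m + 2) → ℕ) (a : ℂ)
    (x : Fin (m + 2) → ℂ) (i : Fin (m + 2)) (t : ℂ) :
    Fcan d w a (Function.update x i t) =
      t ^ (d / w i) + (∑ j ∈ Finset.univ.erase i, x j ^ (d / w j))
        + a * (t * ∏ j ∈ Finset.univ.erase i, x j) := by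
  unfold Fcan
  rw [← Finset.add_sum_erase _ _ (Finset.mem_univ i),
    ← Finset.mul_prod_erase _ _ (Finset.mem_univ i)]
  simp only [Function.update_self]
  congr 2
  · refine Finset.sum_congr rfl fun j hj => ?_
    rw [Function.update_of_ne (Finset.ne_of_mem_erase hj)]
  · congr 1
    refine Finset.prod_congr rfl fun j hj => ?_
    rw [Function.update_of_ne (Finset.ne_of_mem_erase hj)]

lemma deriv_Fcan {m : ℕ} (d : ℕ) (w : Fin (m + 2) → ℕ) (a : ℂ)
    (x : Fin (m + 2) → ℂ) (i : Fin (m + 2)) (y : ℂ) :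
    deriv (fun t : ℂ => Fcan d w a (Function.update x i t)) y =
      (d / w i : ℕ) * y ^ (d / w i - 1) + a * ∏ j ∈ Finset.univ.erase i, x j := by
  simp only [Fcan_update]
  have h := (((hasDerivAt_pow (d / w i) y).add_const
    (∑ j ∈ Finset.univ.erase i, x j ^ (d / w j))).add
      (((hasDerivAt_id y).mul_const (∏ j ∈ Finset.univ.erase i, x j)).const_mul a))
  have h2 := h.deriv
  simp only [one_mul] at h2
  exact h2

lemma hess_diag {m : ℕ} (d : ℕ) (w : Fin (m + 2) → ℕ) (a : ℂ)
    (x : Fin (m + 2) → ℂ) (i : Fin (m + 2)) (hq : 2 ≤ d / w i) :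
    deriv (fun s : ℂ => deriv (fun t : ℂ =>
        Fcan d w a (Function.update (Function.update x i s) i t))
        (Function.update x i s i)) (x i) * x i * x i =
      (d / w i : ℕ) * ((d / w i : ℕ) - 1) * x i ^ (d / w i) := by
  simp only [Function.update_idem, deriv_Fcan, Function.update_self]
  rw [(((hasDerivAt_pow (d / w i - 1) (x i)).const_mul ((d / w i : ℕ) : ℂ)).add_const _).deriv]
  obtain ⟨e, he⟩ := Nat.exists_eq_add_of_le' hq
  rw [he]
  simp
  ring

lemma hess_off {m : ℕ} (d : ℕ) (w : Fin (m + 2) → ℕ) (a : ℂ)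
    (x : Fin (m + 2) → ℂ) (i j : Fin (m + 2)) (hij : i ≠ j) :
    deriv (fun s : ℂ => deriv (fun t : ℂ =>
        Fcan d w a (Function.update (Function.update x j s) i t))
        (Function.update x j s i)) (x j) * x i * x j = a * ∏ k, x k := by
  have hj : j ∈ Finset.univ.erase i := Finset.mem_erase.2 ⟨hij.symm, Finset.mem_univ _⟩
  have key : ∀ s, ∏ k ∈ Finset.univ.erase i, Function.update x j s k =
      s * ∏ k ∈ (Finset.univ.erase i).erase j, x k := by
    intro s
    rw [← Finset.mul_prod_erase _ _ hj, Function.update_self]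
    congr 1
    refine Finset.prod_congr rfl fun k hk => ?_
    rw [Function.update_of_ne (Finset.ne_of_mem_erase hk)]
  simp only [deriv_Fcan, Function.update_of_ne hij, key]
  have h := ((((hasDerivAt_id (x j)).mul_const
    (∏ k ∈ (Finset.univ.erase i).erase j, x k)).const_mul a).const_add
      (((d / w i : ℕ) : ℂ) * x i ^ (d / w i - 1))).deriv
  simp only [id, one_mul] at h
  rw [h, ← Finset.mul_prod_erase _ _ (Finset.mem_univ i), ← Finset.mul_prod_erase _ _ hj]
  ring

lemma crit_iff {m : ℕ} (d : ℕ) (w : Fin (m + 2) → ℕ) (a : ℂ)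
    (hq : ∀ i, 2 ≤ d / w i) (x : Fin (m + 2) → ℂ) (hx : x ≠ 0) :
    (∀ i, deriv (fun t : ℂ => Fcan d w a (Function.update x i t)) (x i) = 0) ↔
    (∀ i, x i ≠ 0) ∧ ∀ i, (d / w i : ℕ) * x i ^ (d / w i) + a * ∏ j, x j = 0 := by
  simp only [deriv_Fcan]
  have key : ∀ i, ((d / w i : ℕ) * x i ^ (d / w i - 1) + a * ∏ j ∈ Finset.univ.erase i, x j) * x i
      = (d / w i : ℕ) * x i ^ (d / w i) + a * ∏ j, x j := by
    intro i
    rw [← Finset.mul_prod_erase _ _ (Finset.mem_univ i)]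
    have : x i ^ (d / w i) = x i ^ (d / w i - 1) * x i := by
      rw [← pow_succ]; congr 1; have := hq i; omega
    rw [this]; ring
  constructor
  · intro h
    have h2 : ∀ i, (d / w i : ℕ) * x i ^ (d / w i) + a * ∏ j, x j = 0 := fun i => by
      rw [← key, h i, zero_mul]
    refine ⟨fun i hi => hx ?_, h2⟩
    have hP : ∏ j, x j = 0 := Finset.prod_eq_zero (Finset.mem_univ i) hi
    funext j
    have h3 := h2 j
    rw [hP, mul_zero, add_zero] at h3
    rcases mul_eq_zero.1 h3 with h4 | h4
    · have := hq j
      rw [Nat.cast_eq_zero] at h4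
      omega
    · exact pow_eq_zero_iff (by have := hq j; omega) |>.1 h4
  · rintro ⟨h0, h⟩ i
    have := h i
    rw [← key] at this
    exact (mul_eq_zero.1 this).resolve_right (h0 i)

theorem stmt_4 {m : ℕ}
    (w : Fin (m + 2) → ℕ) (hw : ∀ i, 0 < w i)
    (hgcd : Finset.univ.gcd w = 1)
    (d : ℕ) (hd : d = ∑ i, w i) (hdvd : ∀ i, w i ∣ d)
    (a : ℂ)
    (S : Set (Fin (m + 2) → ℂ))
    (hS : S = {x | x 0 = 1 ∧ ∀ i : Fin (m + 2),
        deriv (fun t : ℂ => Fcan d w a (Function.update x i t)) (x i) = 0}) :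
    ((∃ x : Fin (m + 2) → ℂ, x ≠ 0 ∧ ∀ i : Fin (m + 2),
        deriv (fun t : ℂ => Fcan d w a (Function.update x i t)) (x i) = 0) ↔
      a ^ d * (∏ i, ((w i : ℕ) : ℂ) ^ w i) + (-1 : ℂ) ^ (d - 1) * (d : ℂ) ^ d = 0) ∧
    (a ^ d * (∏ i, ((w i : ℕ) : ℂ) ^ w i) + (-1 : ℂ) ^ (d - 1) * (d : ℂ) ^ d = 0 →
      S.Finite ∧
      S.ncard * ∏ j : Fin (m + 1), w j.succ = d ^ m ∧
      ∀ x ∈ S,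
        (Matrix.of fun i j : Fin (m + 1) =>
          deriv (fun s : ℂ =>
            deriv (fun t : ℂ =>
                Fcan d w a (Function.update (Function.update x j.succ s) i.succ t))
              (Function.update x j.succ s i.succ)) (x j.succ)).det ≠ 0) := by
  classical
  have hdpos : 0 < d := by
    rw [hd]; exact Finset.sum_pos (fun i _ => hw i) Finset.univ_nonempty
  have hdC : (d : ℂ) ≠ 0 := by exact_mod_cast hdpos.ne'
  have hwC : ∀ i, (w i : ℂ) ≠ 0 := fun i => by exact_mod_cast (hw i).ne'
  have hqw : ∀ i, d / w i * w i = d := fun i => Nat.div_mul_cancel (hdvd i)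
  have hq : ∀ i, 2 ≤ d / w i := by
    intro i
    have hlt : w i < d := by
      obtain ⟨j, hj⟩ := exists_ne i
      rw [hd]
      exact Finset.single_lt_sum hj (Finset.mem_univ i) (Finset.mem_univ j) (hw j)
        (fun _ _ _ => Nat.zero_le _)
    by_contra hcon
    have h1 : d / w i ≤ 1 := by omega
    have := hqw i
    have h3 := Nat.mul_le_mul_right (w i) h1
    omega
  have hqC : ∀ i, ((d / w i : ℕ) : ℂ) * w i = d := fun i => by exact_mod_cast hqw i
  have hdC' : (d : ℂ) = ∑ i, (w i : ℂ) := by rw [hd]; push_cast; rfl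
  set W : ℂ := ∏ i, ((w i : ℕ) : ℂ) ^ w i with hW
  have hWne : W ≠ 0 := Finset.prod_ne_zero_iff.2 fun i _ => pow_ne_zero _ (hwC i)
  have hdisc : (a ^ d * W + (-1 : ℂ) ^ (d - 1) * (d : ℂ) ^ d = 0) ↔ (-a) ^ d * W = (d : ℂ) ^ d := by
    obtain ⟨e, rfl⟩ : ∃ e, d = e + 1 := ⟨d - 1, by omega⟩
    rw [neg_pow a, Nat.add_sub_cancel]
    have h1 : ((-1 : ℂ)) ^ e * (-1) ^ e = 1 := by rw [← mul_pow]; simp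
    rw [pow_succ (-1 : ℂ) e]
    constructor
    · intro h
      linear_combination (-(-1 : ℂ) ^ e) * h + ((e + 1 : ℕ) : ℂ) ^ (e + 1) * h1
    · intro h
      linear_combination (-(-1 : ℂ) ^ e) * h - a ^ (e + 1) * W * h1
  rw [hdisc]
  -- the forward direction
  have hfwd : ∀ x : Fin (m + 2) → ℂ, x ≠ 0 → (∀ i : Fin (m + 2),
        deriv (fun t : ℂ => Fcan d w a (Function.update x i t)) (x i) = 0) →
        (-a) ^ d * W = (d : ℂ) ^ d := by
    intro x hx h
    obtain ⟨h0, h1⟩ := (crit_iff d w a hq x hx).1 h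
    have hP : ∏ i, x i ≠ 0 := Finset.prod_ne_zero_iff.2 fun i _ => h0 i
    set c : ℂ := -a * (∏ i, x i) / d with hc
    have h2 : ∀ i, x i ^ (d / w i) = w i * c := by
      intro i
      have h3 := h1 i
      have h4 := hqC i
      rw [hc]
      field_simp
      linear_combination (w i : ℂ) * h3 - x i ^ (d / w i) * h4
    have h3 : (∏ i, x i) ^ d = W * c ^ d := by
      rw [← Finset.prod_pow]
      calc ∏ i, x i ^ d = ∏ i, ((w i : ℂ) ^ w i * c ^ w i) := by
            refine Finset.prod_congr rfl fun i _ => ?_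
            rw [← mul_pow, ← h2, ← pow_mul, hqw]
        _ = _ := by rw [Finset.prod_mul_distrib, Finset.prod_pow_eq_pow_sum, ← hd]
    rw [hc, div_pow, mul_pow] at h3
    have h4 := pow_ne_zero d hP
    have h5 := pow_ne_zero d hdC
    field_simp at h3
    linear_combination -h3
  have hS2 : ∀ x ∈ S, x 0 = 1 ∧ x ≠ 0 ∧ (∀ i, x i ≠ 0) ∧
      ∀ i, (d / w i : ℕ) * x i ^ (d / w i) + a * ∏ j, x j = 0 := by
    intro x hx
    rw [hS] at hx
    have hx0 : x ≠ 0 := fun h => by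
      have := hx.1
      rw [h] at this
      simp at this
    exact ⟨hx.1, hx0, (crit_iff d w a hq x hx0).1 hx.2⟩
  have hmain : (-a) ^ d * W = (d : ℂ) ^ d → S.Finite ∧
      S.ncard * ∏ j : Fin (m + 1), w j.succ = d ^ m := by
    intro ha
    have ha0 : a ≠ 0 := by
      rintro rfl
      rw [neg_zero, zero_pow hdpos.ne', zero_mul] at ha
      exact pow_ne_zero d hdC ha.symm
    have hw0 := hwC 0
    have hc := count_aux (fun j : Fin (m + 1) => d / w j.succ)
      (fun j => by have := hq j.succ; omega) d hdpos
      (fun j => Nat.div_dvd_of_dvd (hdvd _)) (by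
        intro N hN
        -- d divides w j * N for all j, hence d ∣ N
        have h1 : ∀ j : Fin (m + 1), d ∣ w j.succ * N := by
          intro j
          obtain ⟨c, hc⟩ := hN j
          refine ⟨c, ?_⟩
          rw [hc, ← mul_assoc, mul_comm (w j.succ), hqw]
        have h2 : d ∣ w 0 * N := by
          have h3 : w 0 * N + ∑ j : Fin (m + 1), w j.succ * N = d * N := by
            rw [hd, Finset.sum_mul]
            exact (Fin.sum_univ_succ (fun i => w i * N)).symm
          have h4 : d ∣ ∑ j : Fin (m + 1), w j.succ * N := Finset.dvd_sum fun j _ => h1 j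
          exact (Nat.dvd_add_iff_left h4).2 (h3 ▸ Dvd.intro _ rfl)
        have h5 : d ∣ Finset.univ.gcd (fun i => w i * N) := by
          apply Finset.dvd_gcd
          intro i _
          exact Fin.cases h2 h1 i
        rw [Finset.gcd_mul_right, hgcd] at h5
        simpa using h5)
      (fun j => (w j.succ : ℂ) / w 0) (fun j => div_ne_zero (hwC _) hw0)
      (-d / (a * w 0)) (div_ne_zero (neg_ne_zero.2 hdC) (mul_ne_zero ha0 hw0)) (by
        have h1 : ∀ j : Fin (m + 1), d / (d / w j.succ) = w j.succ := fun j =>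
          Nat.div_div_self (hdvd _) hdpos.ne'
        simp only [h1, div_pow]
        rw [Finset.prod_div_distrib, Finset.prod_pow_eq_pow_sum]
        have h2 : W = (w 0 : ℂ) ^ w 0 * ∏ j : Fin (m + 1), (w j.succ : ℂ) ^ w j.succ := by
          rw [hW, Fin.prod_univ_succ]
        have h3 : (w 0 : ℂ) ^ d = (w 0 : ℂ) ^ w 0 * (w 0 : ℂ) ^ (∑ j : Fin (m + 1), w j.succ) := by
          rw [← pow_add, ← Fin.sum_univ_succ (fun i => w i), ← hd]
        have h6 : (-(d : ℂ)) ^ d = a ^ d * W := by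
          rw [neg_pow, ← ha, neg_pow a, ← mul_assoc, ← mul_assoc, ← mul_pow]
          simp
        rw [h6, mul_pow, h2, h3]
        have h7 := pow_ne_zero d ha0
        have h8 := pow_ne_zero (w 0) hw0
        have h9 := pow_ne_zero (∑ j : Fin (m + 1), w j.succ) hw0
        field_simp)
    set T : Set (Fin (m + 1) → ℂ) := {y | (∀ i : Fin (m + 1),
      y i ^ (d / w i.succ) = (w i.succ : ℂ) / w 0) ∧ ∏ i, y i = -d / (a * w 0)} with hT
    have hST : S = (fun y : Fin (m + 1) → ℂ => (Fin.cons 1 y : Fin (m + 2) → ℂ)) '' T := by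
      ext x
      constructor
      · intro hx
        obtain ⟨h1, -, h0, h2⟩ := hS2 x hx
        have h3 : ∏ i, x i = ∏ i : Fin (m + 1), x i.succ := by
          rw [Fin.prod_univ_succ, h1, one_mul]
        have h4 := h2 0
        rw [h1, one_pow, mul_one] at h4
        have h5 := hqC 0
        refine ⟨fun i => x i.succ, ⟨?_, ?_⟩, ?_⟩
        · intro i
          have h6 := h2 i.succ
          have h7 := hqC i.succ
          rw [eq_div_iff hw0]
          apply mul_left_cancel₀ hdC
          linear_combination (w 0 : ℂ) * w i.succ * (h6 - h4) - (x i.succ) ^ (d / w i.succ) * w 0 * h7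
            + w i.succ * h5
        · rw [← h3, eq_div_iff (mul_ne_zero ha0 hw0)]
          linear_combination (w 0 : ℂ) * h4 - h5
        · funext i
          refine Fin.cases ?_ (fun j => ?_) i
          · simp [h1]
          · simp
      · rintro ⟨y, ⟨hy1, hy2⟩, rfl⟩
        rw [hS]
        have hx0 : (Fin.cons 1 y : Fin (m + 2) → ℂ) ≠ 0 := fun h => by
          have := congrFun h 0
          simp at this
        refine ⟨by simp, (crit_iff d w a hq _ hx0).2 ?_⟩
        have hP : ∏ i, (Fin.cons 1 y : Fin (m + 2) → ℂ) i = -d / (a * w 0) := by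
          rw [Fin.prod_univ_succ]; simpa using hy2
        rw [hP]
        constructor
        · intro i
          refine Fin.cases ?_ (fun j => ?_) i
          · simp
          · simp only [Fin.cons_succ]
            intro h0
            have := hy1 j
            rw [h0, zero_pow (by have := hq j.succ; omega)] at this
            exact div_ne_zero (hwC _) hw0 this.symm
        · intro i
          refine Fin.cases ?_ (fun j => ?_) i
          · have h5 := hqC 0
            simp only [Fin.cons_zero, one_pow]
            field_simp
            linear_combination h5
          · have h5 := hqC j.succ
            simp only [Fin.cons_succ]
            rw [hy1]
            field_simp
            linear_combination h5
    have hinj : Function.Injective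
        (fun y : Fin (m + 1) → ℂ => (Fin.cons 1 y : Fin (m + 2) → ℂ)) :=
      Fin.cons_right_injective (α := fun _ => ℂ) 1
    rw [hST]
    refine ⟨hc.1.image _, ?_⟩
    rw [Set.ncard_image_of_injective _ hinj]
    apply Nat.eq_of_mul_eq_mul_right hdpos
    rw [mul_right_comm, hc.2, ← Finset.prod_mul_distrib]
    simp [hqw, pow_succ]
  refine ⟨⟨fun ⟨x, hx, h⟩ => hfwd x hx h, fun ha => ?_⟩, fun ha => ⟨(hmain ha).1, (hmain ha).2, ?_⟩⟩
  · have hne : S.Nonempty := by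
      rw [Set.nonempty_iff_ne_empty]
      intro h
      have := (hmain ha).2
      rw [h, Set.ncard_empty, zero_mul] at this
      exact (pow_pos hdpos m).ne this
    obtain ⟨x, hx⟩ := hne
    have h1 := (hS2 x hx).2.1
    rw [hS] at hx
    exact ⟨x, h1, hx.2⟩
  · intro x hx hdet
    obtain ⟨h1, -, h0, h2⟩ := hS2 x hx
    obtain ⟨v, hv, hHv⟩ := Matrix.exists_mulVec_eq_zero_iff.2 hdet
    apply hv
    set P : ℂ := a * ∏ j, x j with hP
    have hPne : P ≠ 0 := by
      intro h
      have h3 := h2 0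
      rw [h, h1, one_pow, mul_one, add_zero, Nat.cast_eq_zero] at h3
      have := hq 0
      omega
    set u : Fin (m + 1) → ℂ := fun j => v j / x j.succ with hu
    have hrow : ∀ i : Fin (m + 1), ((d / w i.succ : ℕ) : ℂ) * u i = ∑ j, u j := by
      intro i
      have h3 := congrFun hHv i
      simp only [Matrix.mulVec, dotProduct, Matrix.of_apply, Pi.zero_apply] at h3
      have h4 : ∑ j, (P * u j - if j = i then ((d / w i.succ : ℕ) : ℂ) * P * u j else 0) = 0 := by
        have h3' := congrArg (fun z => x i.succ * z) h3
        simp only [mul_zero, Finset.mul_sum] at h3'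
        refine Eq.trans (Finset.sum_congr rfl fun j _ => ?_) h3'
        have hvj : v j = x j.succ * u j := by
          rw [hu]; field_simp [h0 j.succ]
        rw [hvj]
        by_cases hij : j = i
        · subst hij
          have h5 := hess_diag d w a x j.succ (hq _)
          have h6 := h2 j.succ
          rw [if_pos rfl]
          linear_combination (-u j) * h5 - u j * (((d / w j.succ : ℕ) : ℂ) - 1) * h6
        · rw [if_neg hij]
          have h5 := hess_off d w a x i.succ j.succ (fun h => hij (Fin.succ_injective _ h).symm)
          linear_combination (-u j) * h5
      rw [Finset.sum_sub_distrib, Finset.sum_ite_eq' Finset.univ i, if_pos (Finset.mem_univ i),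
        ← Finset.mul_sum] at h4
      apply mul_left_cancel₀ hPne
      linear_combination -h4
    set s : ℂ := ∑ j, u j with hs
    have hu2 : ∀ i, (d : ℂ) * u i = w i.succ * s := fun i => by
      linear_combination (w i.succ : ℂ) * hrow i - u i * hqC i.succ
    have hs0 : s = 0 := by
      have h3 : (d : ℂ) * s = (∑ i : Fin (m + 1), (w i.succ : ℂ)) * s := by
        rw [Finset.sum_mul, hs, Finset.mul_sum]
        exact Finset.sum_congr rfl fun i _ => hu2 i
      rw [Fin.sum_univ_succ] at hdC'
      have h4 : (w 0 : ℂ) * s = 0 := by linear_combination h3 - s * hdC'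
      exact (mul_eq_zero.1 h4).resolve_left (hwC 0)
    funext i
    have h3 := hu2 i
    rw [hs0, mul_zero] at h3
    have h4 := (mul_eq_zero.1 h3).resolve_left hdC
    simp only [hu] at h4
    exact (div_eq_zero_iff.1 h4).resolve_right (h0 _)
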